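/- arXiv:math/0310276 — 5 statements merged into one kernel-verified Lean document; each statement's English description precedes it below -/
import Mathlib

section
/- Let n ≥ 3. The coefficient of the monomial g₀ gₙ f₀^{Aₙ} f₁^{n−2Aₙ} f₂^{Aₙ} in the expansion of Res(f₀+f₁x+f₂x², g) has the largest absolute value among all coefficients of Res(f₀+f₁x+f₂x², g); that is, its absolute value equals the height H(Res(f₀+f₁x+f₂x², g)). -/
noncomputable section

open MvPolynomial

/-- The quadratic polynomial `p_n(z) = (n-2z+1)(n-2z+2) - z(n-z)`. -/
def pquad (n : ℕ) (z : ℝ) : ℝ :=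
  ((n : ℝ) - 2 * z + 1) * ((n : ℝ) - 2 * z + 2) - z * ((n : ℝ) - z)

/-- The generic Sylvester matrix of a degree-`m` polynomial `f = f₀ + ⋯ + f_m xᵐ` and a
degree-`n` polynomial `g = g₀ + ⋯ + gₙ xⁿ`: its first `n` columns contain the shifted
coefficients of `f` (the indeterminates `Sum.inl i`) and its last `m` columns contain the
shifted coefficients of `g` (the indeterminates `Sum.inr j`). -/
def sylvesterMatrix (m n : ℕ) :
    Matrix (Fin (m + n)) (Fin (m + n)) (MvPolynomial (Fin (m + 1) ⊕ Fin (n + 1)) ℤ) :=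
  Matrix.of fun i j =>
    if (j : ℕ) < n then
      if h : (j : ℕ) ≤ (i : ℕ) ∧ (i : ℕ) - (j : ℕ) ≤ m then
        X (Sum.inl ⟨(i : ℕ) - (j : ℕ), Nat.lt_succ_of_le h.2⟩)
      else 0
    else
      if h : (j : ℕ) - n ≤ (i : ℕ) ∧ (i : ℕ) - ((j : ℕ) - n) ≤ n then
        X (Sum.inr ⟨(i : ℕ) - ((j : ℕ) - n), Nat.lt_succ_of_le h.2⟩)
      else 0

/-- `genRes m n` is the Sylvester resultant `Res(f,g)` of the generic polynomials
`f` of degree `m` and `g` of degree `n`. -/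
def genRes (m n : ℕ) : MvPolynomial (Fin (m + 1) ⊕ Fin (n + 1)) ℤ :=
  (sylvesterMatrix m n).det

/-- The height of an integer multivariate polynomial:
the maximum of the absolute values of its coefficients. -/
def height {σ : Type*} (P : MvPolynomial σ ℤ) : ℕ :=
  P.support.sup fun s => (P.coeff s).natAbs

/-- The absolute values of the coefficients of the power sum `aᵏ + bᵏ`, written as a polynomial
in `a + b` and `a * b`: the coefficient of `(a * b) ^ l * (a + b) ^ (k - 2 * l)`. -/
def lucasCoeff : ℕ → ℕ → ℕ
  | 0, 0 => 2
  | 0, _ + 1 => 0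
  | 1, 0 => 1
  | 1, _ + 1 => 0
  | _ + 2, 0 => 1
  | k + 2, l + 1 => lucasCoeff (k + 1) (l + 1) + lucasCoeff k l

lemma lucasCoeff_zero_right {k : ℕ} (hk : k ≠ 0) : lucasCoeff k 0 = 1 := by
  match k with
  | 0 => exact absurd rfl hk
  | 1 => rfl
  | k + 2 => rfl

lemma lucasCoeff_eq_zero : ∀ {k l : ℕ}, k < 2 * l → lucasCoeff k l = 0
  | 0, 0, h => by omega
  | 0, _ + 1, _ => rfl
  | 1, 0, h => by omega
  | 1, _ + 1, _ => rfl
  | _ + 2, 0, h => by omega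
  | k + 2, l + 1, h => by
    rw [lucasCoeff, lucasCoeff_eq_zero (by omega), lucasCoeff_eq_zero (by omega)]

lemma lucasCoeff_two_mul_self (l : ℕ) : lucasCoeff (2 * l) l = 2 := by
  induction l with
  | zero => rfl
  | succ l ih =>
    rw [show 2 * (l + 1) = 2 * l + 2 by ring, lucasCoeff, ih, lucasCoeff_eq_zero (by omega)]

lemma lucasCoeff_mul (m l : ℕ) :
    (m + l) * lucasCoeff (m + 2 * l) l = (m + 2 * l) * (m + l).choose l := by
  induction l generalizing m with
  | zero =>
    rcases Nat.eq_zero_or_pos m with rfl | hm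
    · simp
    · simp [lucasCoeff_zero_right hm.ne']
  | succ l ihl =>
    induction m with
    | zero =>
      rw [zero_add, zero_add, lucasCoeff_two_mul_self]
      simp
      ring
    | succ m ihm =>
      have h₁ := ihl (m + 1)
      rw [show m + 1 + 2 * (l + 1) = m + 1 + 2 * l + 2 by ring, lucasCoeff,
        show m + 1 + 2 * l + 1 = m + 2 * (l + 1) by ring]
      have h₂ := Nat.choose_succ_right_eq (m + l + 1) l
      rw [show m + l + 1 - l = m + 1 by omega] at h₂
      have h₃ := Nat.choose_succ_succ (m + l + 1) l
      rw [show m + 1 + (l + 1) = (m + l + 1) + 1 by ring, h₃]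
      rw [show m + 1 + l = m + l + 1 by ring] at h₁
      rw [show m + (l + 1) = m + l + 1 by ring] at ihm
      apply Nat.eq_of_mul_eq_mul_left (Nat.succ_pos (m + l))
      simp only [Nat.succ_eq_add_one]
      zify at *
      linear_combination ((m : ℤ) + l + 2) * (h₁ + ihm) + h₂

lemma lucasCoeff_ratio (m l : ℕ) :
    (l + 1) * (m + l + 1) * lucasCoeff (m + 2 * l + 2) (l + 1) =
      (m + 1) * (m + 2) * lucasCoeff (m + 2 * l + 2) l := by
  have h₁ := lucasCoeff_mul m (l + 1)
  have h₂ := lucasCoeff_mul (m + 2) l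
  have h₃ := Nat.choose_succ_right_eq (m + l + 1) l
  have h₄ := Nat.choose_mul_succ_eq (m + l + 1) l
  rw [show m + l + 1 - l = m + 1 by omega] at h₃
  rw [show m + l + 1 + 1 - l = m + 2 by omega, show m + l + 1 + 1 = m + 2 + l by ring] at h₄
  rw [show m + 2 * (l + 1) = m + 2 * l + 2 by ring, show m + (l + 1) = m + l + 1 by ring] at h₁
  rw [show m + 2 + 2 * l = m + 2 * l + 2 by ring] at h₂
  apply Nat.eq_of_mul_eq_mul_left (show 0 < m + 2 + l by omega)
  zify at *
  linear_combination ((m : ℤ) + 2 + l) * (l + 1) * h₁ - (m + 1) * (m + 2) * h₂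
    + ((m : ℤ) + 2 + l) * (m + 2 * l + 2) * h₃ + (m + 1) * (m + 2 * l + 2) * h₄

lemma lucasCoeff_le_succ_left (k l : ℕ) :
    lucasCoeff k (l + 1) ≤ lucasCoeff (k + 1) (l + 1) := by
  match k with
  | 0 => exact Nat.zero_le _
  | k + 1 => exact Nat.le_add_right _ _

lemma lucasCoeff_le_of_le {k n l : ℕ} (hk : k ≠ 0) (h : k ≤ n) :
    lucasCoeff k l ≤ lucasCoeff n l := by
  match l with
  | 0 => rw [lucasCoeff_zero_right hk, lucasCoeff_zero_right (by omega)]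
  | l + 1 => exact monotone_nat_of_le_succ (fun k => lucasCoeff_le_succ_left k l) h

/-- Waring's formula for the power sum of two elements. -/
lemma sum_lucasCoeff {R : Type*} [CommRing R] (a b : R) : ∀ (k N : ℕ), k < N →
    ∑ l ∈ Finset.range N, (-1) ^ l * (lucasCoeff k l : R) * ((a * b) ^ l * (a + b) ^ (k - 2 * l))
      = a ^ k + b ^ k
  | _, 0, h => by omega
  | 0, N + 1, _ => by
    rw [Finset.sum_range_succ', Finset.sum_eq_zero fun l _ => by simp [lucasCoeff]]
    simp [lucasCoeff]
    ring
  | 1, N + 1, _ => by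
    rw [Finset.sum_range_succ', Finset.sum_eq_zero fun l _ => by simp [lucasCoeff]]
    simp [lucasCoeff]
  | k + 2, N + 1, h => by
    have h₁ := sum_lucasCoeff a b (k + 1) (N + 1) (by omega)
    have h₂ := sum_lucasCoeff a b k N (by omega)
    have h₃ : a ^ (k + 2) + b ^ (k + 2) =
        (a + b) * (a ^ (k + 1) + b ^ (k + 1)) - a * b * (a ^ k + b ^ k) := by ring
    rw [h₃, ← h₁, ← h₂, Finset.sum_range_succ', Finset.sum_range_succ', mul_add, Finset.mul_sum,
      Finset.mul_sum, add_sub_right_comm, ← Finset.sum_sub_distrib]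
    congr 1
    · refine Finset.sum_congr rfl fun l _ => ?_
      rw [lucasCoeff, show k + 2 - 2 * (l + 1) = k - 2 * l by omega]
      rcases lt_or_ge (k + 1) (2 * (l + 1)) with hl | hl
      · rw [lucasCoeff_eq_zero hl]
        push_cast
        ring
      · rw [show k - 2 * l = k + 1 - 2 * (l + 1) + 1 by omega]
        push_cast
        ring
    · simp [lucasCoeff_zero_right, lucasCoeff]
      ring

lemma lucasCoeff_le_of_root {n : ℕ} {r : ℝ} (hr : r ≤ (n : ℝ) / 2) (hroot : pquad n r = 0)
    {A : ℕ} (hA : (A : ℤ) = ⌊r⌋) {l : ℕ} (hl : 2 * l ≤ n) :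
    lucasCoeff n l ≤ lucasCoeff n A := by
  have hAr : (A : ℝ) ≤ r := by
    have := Int.floor_le r
    rw [← hA] at this
    exact_mod_cast this
  have hrA : r < A + 1 := by
    have := Int.lt_floor_add_one r
    rw [← hA] at this
    exact_mod_cast this
  have hfac : ∀ z : ℝ, (n - 2 * z + 1) * (n - 2 * z + 2) - z * (n - z) =
      (z - r) * (5 * (z + r) - (5 * n + 6)) := by
    intro z
    rw [pquad] at hroot
    linear_combination hroot
  have h2A : 2 * A ≤ n := by
    have : (2 * A : ℝ) ≤ n := by linarith
    exact_mod_cast this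
  have hup : ∀ j, j + 1 ≤ A → lucasCoeff n j ≤ lucasCoeff n (j + 1) := by
    intro j hj
    obtain ⟨m, rfl⟩ := Nat.exists_eq_add_of_le (show 2 * j + 2 ≤ n by omega)
    have hj' : (j : ℝ) + 1 ≤ A := by exact_mod_cast hj
    have h := hfac (j + 1)
    have hnn : (0 : ℝ) ≤ (j + 1 - r) * (5 * (j + 1 + r) - (5 * ↑(2 * j + 2 + m) + 6)) :=
      mul_nonneg_of_nonpos_of_nonpos (by linarith) (by linarith)
    rw [← h] at hnn
    push_cast at hnn
    have hle : (j + 1) * (m + j + 1) ≤ (m + 1) * (m + 2) := by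
      have : ((j : ℝ) + 1) * (m + j + 1) ≤ (m + 1) * (m + 2) := by nlinarith
      exact_mod_cast this
    have hrat := lucasCoeff_ratio m j
    rw [show m + 2 * j + 2 = 2 * j + 2 + m by ring] at hrat
    refine Nat.le_of_mul_le_mul_left ?_ (show 0 < (j + 1) * (m + j + 1) by positivity)
    rw [hrat]
    exact Nat.mul_le_mul_right _ hle
  have hdown : ∀ j, A ≤ j → 2 * (j + 1) ≤ n → lucasCoeff n (j + 1) ≤ lucasCoeff n j := by
    intro j hj hjn
    obtain ⟨m, rfl⟩ := Nat.exists_eq_add_of_le (show 2 * j + 2 ≤ n by omega)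
    have hj' : (A : ℝ) ≤ j := by exact_mod_cast hj
    have hjn' : 2 * ((j : ℝ) + 1) ≤ ↑(2 * j + 2 + m) := by exact_mod_cast hjn
    have h := hfac (j + 1)
    have hnn : (j + 1 - r) * (5 * (j + 1 + r) - (5 * ↑(2 * j + 2 + m) + 6)) ≤ (0 : ℝ) :=
      mul_nonpos_of_nonneg_of_nonpos (by linarith) (by linarith)
    rw [← h] at hnn
    push_cast at hnn
    have hle : (m + 1) * (m + 2) ≤ (j + 1) * (m + j + 1) := by
      have : ((m : ℝ) + 1) * (m + 2) ≤ (j + 1) * (m + j + 1) := by nlinarith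
      exact_mod_cast this
    have hrat := lucasCoeff_ratio m j
    rw [show m + 2 * j + 2 = 2 * j + 2 + m by ring] at hrat
    refine Nat.le_of_mul_le_mul_left ?_ (show 0 < (m + 1) * (m + 2) by positivity)
    rw [← hrat]
    exact Nat.mul_le_mul_right _ hle
  rcases le_total l A with hlA | hAl
  · exact Nat.decreasingInduction' (P := fun j => lucasCoeff n j ≤ lucasCoeff n A)
      (fun j hj _ ih => (hup j hj).trans ih) hlA le_rfl
  · induction l, hAl using Nat.le_induction with
    | base => exact le_rfl
    | succ j hj ih => exact (hdown j hj hl).trans (ih (by omega))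

/-- The exponent of `g_i g_j f₀^(i+l) f₁^(j-i-2l) f₂^(n-j+l)`. -/
def resExponent {n : ℕ} (i j : Fin (n + 1)) (l : ℕ) : Fin (2 + 1) ⊕ Fin (n + 1) →₀ ℕ :=
  Finsupp.single (Sum.inl 0) ((i : ℕ) + l) +
    Finsupp.single (Sum.inl 1) ((j : ℕ) - i - 2 * l) +
    Finsupp.single (Sum.inl 2) (n - j + l) +
    (Finsupp.single (Sum.inr i) 1 + Finsupp.single (Sum.inr j) 1)

/-- The coefficient of the monomial with exponent `resExponent i j l` in the resultant, where
`k = j - i`. -/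
def resCoeff (k l : ℕ) : ℤ :=
  if k = 0 then (if l = 0 then 1 else 0) else (-1) ^ l * (-1) ^ (k - 2 * l) * lucasCoeff k l

lemma resExponent_injective {n : ℕ} {i j i' j' : Fin (n + 1)} {l l' : ℕ} (hij : i ≤ j)
    (hij' : i' ≤ j') (h : resExponent i j l = resExponent i' j' l') :
    i = i' ∧ j = j' ∧ l = l' := by
  have hr : ∀ x : Fin (n + 1), (if i = x then 1 else 0) + (if j = x then 1 else 0) =
      (if i' = x then 1 else 0) + (if j' = x then 1 else 0) := by
    intro x
    simpa [resExponent, Finsupp.single_apply] using DFunLike.congr_fun h (Sum.inr x)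
  have hl : (i : ℕ) + l = i' + l' := by
    simpa [resExponent, Finsupp.single_apply] using DFunLike.congr_fun h (Sum.inl 0)
  have h1 := hr i
  have h2 := hr j
  have h3 := hr i'
  have h4 := hr j'
  have : i = i' ∧ j = j' := by grind
  obtain ⟨rfl, rfl⟩ := this
  exact ⟨rfl, rfl, by omega⟩

/-- The explicit expansion of the resultant of a quadratic polynomial. -/
def resExpansion (n : ℕ) : MvPolynomial (Fin (2 + 1) ⊕ Fin (n + 1)) ℤ :=
  ∑ i : Fin (n + 1), ∑ j : Fin (n + 1), if i ≤ j then
    ∑ l ∈ Finset.range (n + 1), monomial (resExponent i j l) (resCoeff ((j : ℕ) - i) l) else 0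

lemma coeff_resExpansion {n : ℕ} {i j : Fin (n + 1)} {l : ℕ} (hij : i ≤ j) (hl : l ≤ n) :
    (resExpansion n).coeff (resExponent i j l) = resCoeff ((j : ℕ) - i) l := by
  rw [resExpansion, coeff_sum, Finset.sum_eq_single i, coeff_sum, Finset.sum_eq_single j,
    if_pos hij, coeff_sum, Finset.sum_eq_single l, coeff_monomial, if_pos rfl]
  · intro l' _ hne
    rw [coeff_monomial, if_neg fun h => hne (resExponent_injective hij hij h).2.2]
  · intro h
    exact absurd (Finset.mem_range.2 (by omega)) h
  · intro j' _ hne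
    split_ifs with hij'
    · rw [coeff_sum]
      refine Finset.sum_eq_zero fun l' _ => ?_
      rw [coeff_monomial, if_neg fun h => hne (resExponent_injective hij' hij h).2.1]
    · exact coeff_zero _
  · simp
  · intro i' _ hne
    rw [coeff_sum]
    refine Finset.sum_eq_zero fun j' _ => ?_
    split_ifs with hij'
    · rw [coeff_sum]
      refine Finset.sum_eq_zero fun l' _ => ?_
      rw [coeff_monomial, if_neg fun h => hne (resExponent_injective hij' hij h).1]
    · exact coeff_zero _
  · simp

lemma exists_of_coeff_resExpansion_ne_zero {n : ℕ} {s : Fin (2 + 1) ⊕ Fin (n + 1) →₀ ℕ}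
    (hs : (resExpansion n).coeff s ≠ 0) :
    ∃ i j : Fin (n + 1), ∃ l ≤ n, i ≤ j ∧ s = resExponent i j l := by
  contrapose! hs
  rw [resExpansion, coeff_sum]
  refine Finset.sum_eq_zero fun i _ => ?_
  rw [coeff_sum]
  refine Finset.sum_eq_zero fun j _ => ?_
  split_ifs with hij
  · rw [coeff_sum]
    refine Finset.sum_eq_zero fun l hl => ?_
    rw [coeff_monomial, if_neg]
    exact fun h => hs i j l (by simpa [Nat.lt_succ_iff] using hl) hij h.symm
  · exact coeff_zero _

lemma natAbs_resCoeff {k l : ℕ} (hk : k ≠ 0) : (resCoeff k l).natAbs = lucasCoeff k l := by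
  simp [resCoeff, hk, Int.natAbs_mul, Int.natAbs_pow]

lemma sum_sum_eq_sum_sum_le {ι R : Type*} [Fintype ι] [LinearOrder ι] [AddCommMonoid R]
    (h : ι → ι → R) :
    ∑ i, ∑ j, h i j = ∑ i, ∑ j, if i ≤ j then (if i = j then h i i else h i j + h j i) else 0 := by
  have h₁ : ∀ i j, h i j = (if i ≤ j then h i j else 0) + (if j < i then h i j else 0) := by
    intro i j
    rcases le_or_gt i j with hij | hij
    · simp [hij, hij.not_gt]
    · simp [hij, hij.not_ge]
  calc ∑ i, ∑ j, h i j
      = ∑ i, ∑ j, ((if i ≤ j then h i j else 0) + (if j < i then h i j else 0)) := by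
        simp_rw [← h₁]
    _ = ∑ i, ∑ j, (if i ≤ j then h i j else 0) + ∑ i, ∑ j, (if i < j then h j i else 0) := by
        simp_rw [Finset.sum_add_distrib]
        congr 1
        exact Finset.sum_comm
    _ = _ := by
        simp_rw [← Finset.sum_add_distrib]
        refine Finset.sum_congr rfl fun i _ => Finset.sum_congr rfl fun j _ => ?_
        rcases lt_trichotomy i j with hij | rfl | hij
        · simp [hij, hij.le, hij.ne]
        · simp
        · simp [hij.not_gt, hij.not_ge]

lemma monomial_resExponent {n : ℕ} (i j : Fin (n + 1)) (l : ℕ) (z : ℤ) :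
    monomial (resExponent i j l) z =
      C z * (X (Sum.inl 0) ^ ((i : ℕ) + l) * X (Sum.inl 1) ^ ((j : ℕ) - i - 2 * l) *
        X (Sum.inl 2) ^ (n - j + l) * (X (Sum.inr i) * X (Sum.inr j))) := by
  simp only [resExponent, X, monomial_pow, monomial_mul, C_mul_monomial, mul_one, one_pow,
    Finsupp.smul_single, smul_eq_mul]

lemma map_resExpansion {R : Type*} [CommRing R] {n : ℕ}
    (φ : MvPolynomial (Fin (2 + 1) ⊕ Fin (n + 1)) ℤ →+* R) {c a b : R}
    (h₀ : φ (X (Sum.inl 0)) = c * (a * b)) (h₁ : φ (X (Sum.inl 1)) = -(c * (a + b)))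
    (h₂ : φ (X (Sum.inl 2)) = c) :
    φ (resExpansion n) = c ^ n * ((∑ i : Fin (n + 1), φ (X (Sum.inr i)) * a ^ (i : ℕ)) *
      ∑ i : Fin (n + 1), φ (X (Sum.inr i)) * b ^ (i : ℕ)) := by
  rw [Finset.sum_mul_sum, sum_sum_eq_sum_sum_le, resExpansion, map_sum, Finset.mul_sum]
  refine Finset.sum_congr rfl fun i _ => ?_
  rw [map_sum, Finset.mul_sum]
  refine Finset.sum_congr rfl fun j _ => ?_
  split_ifs with hij heq
  · subst heq
    rw [Finset.sum_eq_single 0]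
    · have hc : c ^ n = c ^ (i : ℕ) * c ^ (n - (i : ℕ)) := by
        rw [← pow_add]
        congr 1
        omega
      rw [monomial_resExponent, hc]
      simp [resCoeff, h₀, h₂]
      ring
    · intro l _ hl
      simp [resCoeff, hl]
    · simp
  · have hij' : (i : ℕ) ≤ j := hij
    have hne : (j : ℕ) - i ≠ 0 := by
      have : (i : ℕ) ≠ j := fun h => heq (Fin.ext h)
      omega
    have key := sum_lucasCoeff (c * a) (c * b) ((j : ℕ) - i) (n + 1) (by omega)
    obtain ⟨k, hk⟩ := Nat.exists_eq_add_of_le hij'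
    trans φ (X (Sum.inr i)) * φ (X (Sum.inr j)) * (c * (a * b)) ^ (i : ℕ) * c ^ (n - (j : ℕ)) *
      ((c * a) ^ ((j : ℕ) - i) + (c * b) ^ ((j : ℕ) - i))
    · rw [← key, map_sum, Finset.mul_sum]
      refine Finset.sum_congr rfl fun l _ => ?_
      rw [monomial_resExponent]
      simp [resCoeff, pow_add, h₀, h₁, h₂, hne]
      rw [neg_pow (c * (a + b)), ← mul_add c a b]
      have hs : ((-1 : R) ^ ((j : ℕ) - i - 2 * l)) * (-1) ^ ((j : ℕ) - i - 2 * l) = 1 := by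
        rw [← mul_pow]
        simp
      linear_combination (φ (X (Sum.inr i)) * φ (X (Sum.inr j)) * (c * (a * b)) ^ (i : ℕ) *
        c ^ (n - (j : ℕ)) * (-1) ^ l * lucasCoeff ((j : ℕ) - i) l * (c * (a * b)) ^ l * c ^ l *
        (c * (a + b)) ^ ((j : ℕ) - i - 2 * l)) * hs
    · have hc : c ^ n = c ^ (j : ℕ) * c ^ (n - (j : ℕ)) := by
        rw [← pow_add]
        congr 1
        omega
      rw [hc, show (j : ℕ) - i = k by omega]
      generalize c ^ (n - (j : ℕ)) = e
      rw [hk]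
      ring
  · simp

/-- The generic polynomial of degree `n`, with coefficients the indeterminates `X (e i)`. -/
def genPoly {σ : Type*} (n : ℕ) (e : Fin (n + 1) → σ) : Polynomial (MvPolynomial σ ℤ) :=
  ∑ i : Fin (n + 1), Polynomial.monomial (i : ℕ) (X (e i))

lemma coeff_genPoly {σ : Type*} {n k : ℕ} (e : Fin (n + 1) → σ) (hk : k < n + 1) :
    (genPoly n e).coeff k = X (e ⟨k, hk⟩) := by
  rw [genPoly, Polynomial.finsetSum_coeff, Finset.sum_eq_single ⟨k, hk⟩]
  · simp
  · intro i _ hi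
    rw [Polynomial.coeff_monomial, if_neg]
    exact fun h => hi (Fin.ext h)
  · simp

lemma natDegree_genPoly_le {σ : Type*} (n : ℕ) (e : Fin (n + 1) → σ) :
    (genPoly n e).natDegree ≤ n :=
  Polynomial.natDegree_sum_le_of_forall_le _ _ fun i _ =>
    (Polynomial.natDegree_monomial_le _).trans (Nat.lt_succ_iff.1 i.2)

lemma genRes_eq_resultant (m n : ℕ) :
    genRes m n = (genPoly n Sum.inr).resultant (genPoly m Sum.inl) n m := by
  rw [Polynomial.resultant, genRes, ← Matrix.det_reindex_self (finCongr (add_comm m n))]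
  congr 1
  ext1 i j
  induction j using Fin.addCases with
  | left j =>
    simp only [Polynomial.sylvester, sylvesterMatrix, Matrix.reindex_apply, Matrix.submatrix_apply,
      Matrix.of_apply, Fin.addCases_left, Set.mem_Icc, finCongr_symm, finCongr_apply, Fin.val_cast,
      Fin.val_castAdd, j.2, if_true]
    split_ifs with h₁ h₂ h₂
    · rw [coeff_genPoly _ (by omega)]
    · omega
    · omega
    · rfl
  | right j =>
    simp only [Polynomial.sylvester, sylvesterMatrix, Matrix.reindex_apply, Matrix.submatrix_apply,
      Matrix.of_apply, Fin.addCases_right, Set.mem_Icc, finCongr_symm, finCongr_apply,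
      Fin.val_cast, Fin.val_natAdd, not_lt.2 (Nat.le_add_right n (j : ℕ)), if_false,
      Nat.add_sub_cancel_left]
    split_ifs with h₁ h₂ h₂
    · rw [coeff_genPoly _ (by omega)]
    · omega
    · omega
    · rfl

lemma genRes_two (n : ℕ) : genRes 2 n = resExpansion n := by
  let R := MvPolynomial (Fin (2 + 1) ⊕ Fin (n + 1)) ℤ
  let K := AlgebraicClosure (FractionRing R)
  let φ : R →+* K := (algebraMap (FractionRing R) K).comp (algebraMap R (FractionRing R))
  have hφ : Function.Injective φ :=
    (algebraMap (FractionRing R) K).injective.comp (IsFractionRing.injective R (FractionRing R))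
  apply hφ
  set f : Polynomial K := (genPoly 2 Sum.inl : Polynomial R).map φ with hf
  set g : Polynomial K := (genPoly n Sum.inr : Polynomial R).map φ with hg
  have hf0 : f.coeff 0 = φ (X (Sum.inl 0)) := by
    rw [hf, Polynomial.coeff_map, coeff_genPoly _ (by omega)]; rfl
  have hf1 : f.coeff 1 = φ (X (Sum.inl 1)) := by
    rw [hf, Polynomial.coeff_map, coeff_genPoly _ (by omega)]; rfl
  have hf2 : f.coeff 2 = φ (X (Sum.inl 2)) := by
    rw [hf, Polynomial.coeff_map, coeff_genPoly _ (by omega)]; rfl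
  have hdeg : f.natDegree = 2 := by
    refine le_antisymm (Polynomial.natDegree_map_le.trans (natDegree_genPoly_le _ _))
      (Polynomial.le_natDegree_of_ne_zero ?_)
    rw [hf2, Ne, map_eq_zero_iff φ hφ]
    exact X_ne_zero _
  have hsplits : f.Splits := IsAlgClosed.splits f
  have hgdeg : g.natDegree ≤ n := Polynomial.natDegree_map_le.trans (natDegree_genPoly_le _ _)
  have hgeval : ∀ x, g.eval x = ∑ i : Fin (n + 1), φ (X (Sum.inr i)) * x ^ (i : ℕ) := by
    intro x
    simp [hg, genPoly, Polynomial.map_sum, Polynomial.eval_finsetSum]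
  have hcard : f.roots.card = 2 := by
    exact (Polynomial.splits_iff_card_roots.1 hsplits).trans hdeg
  obtain ⟨a, b, hab⟩ := Multiset.card_eq_two.1 hcard
  have hprod := hsplits.eq_prod_roots
  rw [hab, Polynomial.leadingCoeff, hdeg] at hprod
  have hprod' : f = Polynomial.C (f.coeff 2 * (a * b)) +
      Polynomial.C (-(f.coeff 2 * (a + b))) * Polynomial.X +
      Polynomial.C (f.coeff 2) * Polynomial.X ^ 2 := by
    generalize f.coeff 2 = c at hprod ⊢
    rw [hprod]
    simp
    ring
  have hres := Polynomial.resultant_eq_prod_eval f g n hgdeg hsplits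
  rw [hdeg, hab, Polynomial.leadingCoeff, hdeg] at hres
  rw [genRes_eq_resultant, ← Polynomial.resultant_map_map, Polynomial.resultant_comm, ← hf, ← hg,
    hres, map_resExpansion φ (a := a) (b := b) (c := f.coeff 2) _ _ hf2.symm]
  · simp [hgeval, mul_comm n 2, pow_mul]
  · rw [← hf0]
    conv_lhs => rw [hprod']
    simp
  · rw [← hf1]
    conv_lhs => rw [hprod']
    simp [Polynomial.coeff_X_pow, -neg_add_rev, Polynomial.coeff_C]

/-- For `n ≥ 3`, the coefficient of the monomial `g₀ gₙ f₀^{Aₙ} f₁^{n-2Aₙ} f₂^{Aₙ}` in the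
expansion of `Res(f₀+f₁x+f₂x², g)` has the largest absolute value among all coefficients:
its absolute value equals the height of the resultant. Here `Aₙ = ⌊rₙ⌋` where `rₙ` is the
(unique) root of `p_n` in `[0, n/2]`. -/
theorem coeff_height_quadratic (n : ℕ) (hn : 3 ≤ n) (r : ℝ)
    (hr : r ∈ Set.Icc 0 ((n : ℝ) / 2)) (hroot : pquad n r = 0)
    (A : ℕ) (hA : (A : ℤ) = ⌊r⌋) :
    ((genRes 2 n).coeff
        (Finsupp.single (Sum.inl 0) A + Finsupp.single (Sum.inl 1) (n - 2 * A) +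
          Finsupp.single (Sum.inl 2) A +
          (Finsupp.single (Sum.inr 0) 1 + Finsupp.single (Sum.inr (Fin.last n)) 1))).natAbs
      = height (genRes 2 n) := by
  have hAn : A ≤ n := by
    have h₁ : ((A : ℤ) : ℝ) ≤ r := hA ▸ Int.floor_le r
    have h₂ : (A : ℝ) ≤ n := by
      have := hr.2
      have : (0 : ℝ) ≤ n := Nat.cast_nonneg n
      push_cast at h₁
      linarith
    exact_mod_cast h₂
  have hexp : Finsupp.single (Sum.inl 0) A + Finsupp.single (Sum.inl 1) (n - 2 * A) +
      Finsupp.single (Sum.inl 2) A +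
      (Finsupp.single (Sum.inr 0) 1 + Finsupp.single (Sum.inr (Fin.last n)) 1) =
      resExponent (0 : Fin (n + 1)) (Fin.last n) A := by
    simp [resExponent]
  have hcoeff : ((resExpansion n).coeff (resExponent 0 (Fin.last n) A)).natAbs =
      lucasCoeff n A := by
    rw [coeff_resExpansion (Fin.zero_le _) hAn, natAbs_resCoeff (by simp; omega)]
    simp
  rw [hexp, genRes_two]
  apply le_antisymm
  · by_cases h : (resExpansion n).coeff (resExponent 0 (Fin.last n) A) = 0
    · simp [h]
    · exact Finset.le_sup (f := fun s => ((resExpansion n).coeff s).natAbs) (mem_support_iff.2 h)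
  · refine Finset.sup_le fun s hs => ?_
    obtain ⟨i, j, l, hl, hij, rfl⟩ :=
      exists_of_coeff_resExpansion_ne_zero (mem_support_iff.1 hs)
    rw [hcoeff, coeff_resExpansion hij hl]
    by_cases hk : (j : ℕ) - i = 0
    · have h₁ : (resCoeff ((j : ℕ) - i) l).natAbs ≤ 1 := by
        rw [hk, resCoeff]
        split_ifs <;> simp_all
      refine h₁.trans ?_
      rw [← lucasCoeff_zero_right (show n ≠ 0 by omega)]
      exact lucasCoeff_le_of_root hr.2 hroot hA (by omega)
    · rw [natAbs_resCoeff hk]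
      by_cases h2l : 2 * l ≤ n
      · exact (lucasCoeff_le_of_le hk (by omega)).trans
          (lucasCoeff_le_of_root hr.2 hroot hA h2l)
      · rw [lucasCoeff_eq_zero (by omega)]
        exact Nat.zero_le _
end
end

section
/- Let n ≥ 3 and for an integer z with 0 ≤ z ≤ ⌊n/2⌋ set P(z) = (n−z−1)! / ((n−2z)! · z!). Then P(z)−P(z−1) = ((n−z−1)!/((n−2z+2)! z!)) · p_n(z) for 1 ≤ z ≤ ⌊n/2⌋, P is increasing on {0,1,…,Aₙ} and decreasing on {Aₙ, Aₙ+1, …, ⌊n/2⌋}; in particular P attains its maximum over {0,1,…,⌊n/2⌋} at z = Aₙ. -/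
noncomputable section

open MvPolynomial

theorem pquad_sub (n : ℕ) (x r : ℝ) :
    pquad n x - pquad n r = (x - r) * (5 * (x + r) - 5 * n - 6) := by
  unfold pquad
  ring

theorem pquad_antitoneOn (n : ℕ) : AntitoneOn (pquad n) (Set.Iic ((n : ℝ) / 2)) := by
  intro x hx y hy hxy
  rw [Set.mem_Iic] at hx hy
  nlinarith [pquad_sub n y x]

theorem factorial_quotient_sub (y m : ℕ) :
    ((y + m).factorial : ℝ) / (m.factorial * (y + 1).factorial) -
        ((y + m + 1).factorial : ℝ) / ((m + 2).factorial * y.factorial) =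
      ((y + m).factorial : ℝ) / ((m + 2).factorial * (y + 1).factorial) *
        pquad (2 * y + 2 + m) ((y + 1 : ℕ) : ℝ) := by
  have hm : (m.factorial : ℝ) ≠ 0 := by positivity
  have hy : (y.factorial : ℝ) ≠ 0 := by positivity
  simp only [Nat.factorial_succ, pquad]
  push_cast
  field_simp
  ring

/-- For `n ≥ 3` and `P(z) = (n-z-1)! / ((n-2z)! ⬝ z!)` for integers `0 ≤ z ≤ ⌊n/2⌋`:
the difference identity `P(z) - P(z-1) = ((n-z-1)!/((n-2z+2)! z!)) ⬝ p_n(z)` holds for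
`1 ≤ z ≤ ⌊n/2⌋`, `P` is increasing on `{0,…,Aₙ}` and decreasing on `{Aₙ,…,⌊n/2⌋}`; in
particular `P` attains its maximum over `{0,…,⌊n/2⌋}` at `z = Aₙ`.  Here `Aₙ = ⌊rₙ⌋` and
`rₙ` is the (unique) root of `p_n` in `[0, n/2]`. -/
theorem P_difference_and_max (n : ℕ) (hn : 3 ≤ n) (r : ℝ)
    (hr : r ∈ Set.Icc 0 ((n : ℝ) / 2)) (hroot : pquad n r = 0)
    (A : ℕ) (hA : (A : ℤ) = ⌊r⌋)
    (P : ℕ → ℝ)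
    (hP : ∀ z, z ≤ n / 2 →
      P z = (Nat.factorial (n - z - 1) : ℝ) /
        (Nat.factorial (n - 2 * z) * Nat.factorial z)) :
    (∀ z, 1 ≤ z → z ≤ n / 2 →
      P z - P (z - 1) =
        (Nat.factorial (n - z - 1) : ℝ) /
          (Nat.factorial (n - 2 * z + 2) * Nat.factorial z) * pquad n z) ∧
    (∀ z w, z ≤ w → w ≤ A → P z ≤ P w) ∧
    (∀ z w, A ≤ z → z ≤ w → w ≤ n / 2 → P w ≤ P z) ∧
    (∀ z, z ≤ n / 2 → P z ≤ P A) := by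
  have hdiff : ∀ z, 1 ≤ z → z ≤ n / 2 →
      P z - P (z - 1) =
        (Nat.factorial (n - z - 1) : ℝ) /
          (Nat.factorial (n - 2 * z + 2) * Nat.factorial z) * pquad n z := by
    intro z hz hzn
    rw [hP z hzn, hP (z - 1) (by omega)]
    obtain ⟨y, rfl⟩ : ∃ y, z = y + 1 := ⟨z - 1, by omega⟩
    obtain ⟨m, rfl⟩ : ∃ m, n = 2 * y + 2 + m := ⟨n - (2 * y + 2), by omega⟩
    rw [show 2 * y + 2 + m - (y + 1) - 1 = y + m by omega,
      show 2 * y + 2 + m - 2 * (y + 1) = m by omega,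
      show y + 1 - 1 = y by omega,
      show 2 * y + 2 + m - y - 1 = y + m + 1 by omega,
      show 2 * y + 2 + m - 2 * y = m + 2 by omega]
    exact factorial_quotient_sub y m
  have hle_half : ∀ z : ℕ, z ≤ n / 2 → (z : ℝ) ≤ (n : ℝ) / 2 := fun z hz =>
    (Nat.cast_le.mpr hz).trans Nat.cast_div_le
  have hA_floor : A = ⌊r⌋₊ := by
    have := Int.natCast_floor_eq_floor hr.1
    omega
  have hAr : (A : ℝ) ≤ r := hA_floor ▸ Nat.floor_le hr.1
  have hrA : r < A + 1 := hA_floor ▸ Nat.lt_floor_add_one r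
  have hAn : A ≤ n / 2 := by
    have h : ((2 * A : ℕ) : ℝ) ≤ n := by
      push_cast
      linarith [hr.2]
    have := Nat.cast_le.mp h
    omega
  have hstep_up : ∀ z, z + 1 ≤ A → P z ≤ P (z + 1) := by
    intro z hz
    have hd := hdiff (z + 1) (by omega) (by omega)
    have hzr : ((z + 1 : ℕ) : ℝ) ≤ r := (Nat.cast_le.mpr hz).trans hAr
    have hp : 0 ≤ pquad n ((z + 1 : ℕ) : ℝ) :=
      hroot ▸ pquad_antitoneOn n (hzr.trans hr.2) hr.2 hzr
    rw [Nat.add_sub_cancel] at hd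
    exact sub_nonneg.mp (hd ▸ mul_nonneg (by positivity) hp)
  have hstep_down : ∀ z, A ≤ z → z + 1 ≤ n / 2 → P (z + 1) ≤ P z := by
    intro z hz hzn
    have hd := hdiff (z + 1) (by omega) hzn
    have hrz : r ≤ ((z + 1 : ℕ) : ℝ) := by
      have : (A : ℝ) ≤ z := Nat.cast_le.mpr hz
      push_cast
      linarith
    have hp : pquad n ((z + 1 : ℕ) : ℝ) ≤ 0 :=
      hroot ▸ pquad_antitoneOn n hr.2 (hle_half _ hzn) hrz
    rw [Nat.add_sub_cancel] at hd
    exact sub_nonpos.mp (hd ▸ mul_nonpos_of_nonneg_of_nonpos (by positivity) hp)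
  have hup : ∀ z w, z ≤ w → w ≤ A → P z ≤ P w := by
    intro z w hzw
    induction w, hzw using Nat.le_induction with
    | base => exact fun _ => le_rfl
    | succ w _ ih => exact fun hw => (ih (by omega)).trans (hstep_up w hw)
  have hdown : ∀ z w, A ≤ z → z ≤ w → w ≤ n / 2 → P w ≤ P z := by
    intro z w hz hzw
    induction w, hzw using Nat.le_induction with
    | base => exact fun _ => le_rfl
    | succ w hw ih => exact fun hwn => (hstep_down w (hz.trans hw) hwn).trans (ih (by omega))
  refine ⟨hdiff, hup, hdown, fun z hz => ?_⟩
  rcases le_total z A with h | h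
  · exact hup z A h le_rfl
  · exact hdown A z le_rfl h hz
end
end

section
/- The sequence Aₙ/n converges as n → ∞, and lim_{n→∞} Aₙ/n = (5 − √5)/10. -/
noncomputable section

open MvPolynomial

/-- The smaller root of `p_n`. -/
def pquadRoot (n : ℕ) : ℝ := (5 * (n : ℝ) + 6 - √(5 * (n : ℝ) ^ 2 - 4)) / 10

lemma pquad_pquadRoot {n : ℕ} (hn : 1 ≤ n) : pquad n (pquadRoot n) = 0 := by
  have hn' : (1 : ℝ) ≤ n := by exact_mod_cast hn
  have hs := Real.sq_sqrt (show (0 : ℝ) ≤ 5 * (n : ℝ) ^ 2 - 4 by nlinarith)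
  unfold pquad pquadRoot
  linear_combination (1 / 20) * hs

lemma pquadRoot_mem_Icc {n : ℕ} (hn : 3 ≤ n) : pquadRoot n ∈ Set.Icc 0 ((n : ℝ) / 2) := by
  have hn' : (3 : ℝ) ≤ n := by exact_mod_cast hn
  have hlower : 6 ≤ √(5 * (n : ℝ) ^ 2 - 4) := Real.le_sqrt_of_sq_le (by nlinarith)
  have hupper : √(5 * (n : ℝ) ^ 2 - 4) ≤ 5 * n + 6 :=
    Real.sqrt_le_iff.mpr ⟨by positivity, by nlinarith⟩
  unfold pquadRoot
  constructor <;> linarith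

lemma abs_floor_pquadRoot_sub_le {n : ℕ} (hn : 3 ≤ n) :
    |(⌊pquadRoot n⌋ : ℝ) - (5 - √5) / 10 * n| ≤ 1 := by
  have hn' : (3 : ℝ) ≤ n := by exact_mod_cast hn
  have h5 : √5 ^ 2 = 5 := Real.sq_sqrt (by norm_num)
  have h5' : 2 ≤ √5 := Real.le_sqrt_of_sq_le (by norm_num)
  have hmul : 6 ≤ √5 * n := by nlinarith
  have hsq : (√5 * n) ^ 2 = 5 * (n : ℝ) ^ 2 := by rw [mul_pow, h5]
  have hlower : √5 * n - 1 ≤ √(5 * (n : ℝ) ^ 2 - 4) := Real.le_sqrt_of_sq_le (by nlinarith)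
  have hupper : √(5 * (n : ℝ) ^ 2 - 4) ≤ √5 * n :=
    Real.sqrt_le_iff.mpr ⟨by positivity, by linarith⟩
  have hfloor_le := Int.floor_le (pquadRoot n)
  have hlt_floor := Int.lt_floor_add_one (pquadRoot n)
  have hroot : pquadRoot n = (5 * (n : ℝ) + 6 - √(5 * (n : ℝ) ^ 2 - 4)) / 10 := rfl
  rw [abs_le]
  constructor <;> linarith

/-- The sequence `Aₙ/n` converges to `(5 - √5)/10` as `n → ∞`, where for `n ≥ 3`,
`Aₙ = ⌊rₙ⌋` and `rₙ` is the (unique) root of `p_n` in `[0, n/2]`. -/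
theorem A_div_n_tendsto (A : ℕ → ℕ)
    (hA : ∀ n : ℕ, 3 ≤ n → ∀ r : ℝ, r ∈ Set.Icc 0 ((n : ℝ) / 2) → pquad n r = 0 →
      (A n : ℤ) = ⌊r⌋) :
    Filter.Tendsto (fun n : ℕ => (A n : ℝ) / n) Filter.atTop
      (nhds ((5 - Real.sqrt 5) / 10)) := by
  rw [tendsto_iff_dist_tendsto_zero]
  refine squeeze_zero' (Filter.Eventually.of_forall fun _ => dist_nonneg) ?_
    (tendsto_one_div_atTop_nhds_zero_nat (𝕜 := ℝ))
  filter_upwards [Filter.eventually_ge_atTop 3] with n hn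
  have hpos : (0 : ℝ) < n := by exact_mod_cast (by lia : 0 < n)
  have hfloor : (A n : ℝ) = ⌊pquadRoot n⌋ := by
    exact_mod_cast hA n hn _ (pquadRoot_mem_Icc hn) (pquad_pquadRoot (by lia))
  have hsub : (A n : ℝ) / n - (5 - √5) / 10 = (⌊pquadRoot n⌋ - (5 - √5) / 10 * n) / n := by
    rw [hfloor]
    field_simp
  rw [Real.dist_eq, hsub, abs_div, abs_of_pos hpos]
  gcongr
  exact abs_floor_pquadRoot_sub_le hn
end
end

section
/- The function F satisfies the recurrence F(m, k, k', m') = F(m, k, k'−1, m') − F(m, k−1, k', m'−1) + F(m−1, k, k', m'−2) for all nonnegative integers m, k, k', m' with m+k+k'+m' ≥ 1, where F(0,0,0,0) = 1 and F(m,k,k',m') = 0 if any of m, k, k', m' is negative. -/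
noncomputable section

open MvPolynomial

/-- The `N × N` banded Toeplitz matrix over `ℤ[f₀,f₁,f₂,f₃]` whose `(i,j)` entry is
`f_{2+i-j}` (interpreted as `0` when `2+i-j ∉ {0,1,2,3}`): `f₂` on the main diagonal, `f₁` on
the first superdiagonal, `f₀` on the second superdiagonal and `f₃` on the first subdiagonal. -/
def toeplitzF (N : ℕ) : Matrix (Fin N) (Fin N) (MvPolynomial (Fin 4) ℤ) :=
  Matrix.of fun i j =>
    if h : 0 ≤ 2 + (i : ℤ) - (j : ℤ) ∧ 2 + (i : ℤ) - (j : ℤ) ≤ 3 then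
      X ⟨(2 + (i : ℤ) - (j : ℤ)).toNat, by omega⟩
    else 0

/-- `Fc m k k' m'` is the coefficient of the monomial `f₀^m f₁^k f₂^{k'} f₃^{m'}` in the
determinant of the banded Toeplitz matrix of dimension `m+k+k'+m'`, with the conventions
`Fc 0 0 0 0 = 1`, and `Fc m k k' m' = 0` whenever one of the arguments is negative. -/
def Fc (m k k' m' : ℤ) : ℤ :=
  if 0 ≤ m ∧ 0 ≤ k ∧ 0 ≤ k' ∧ 0 ≤ m' then
    if m = 0 ∧ k = 0 ∧ k' = 0 ∧ m' = 0 then 1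
    else
      (toeplitzF (m + k + k' + m').toNat).det.coeff
        (Finsupp.single 0 m.toNat + Finsupp.single 1 k.toNat +
          Finsupp.single 2 k'.toNat + Finsupp.single 3 m'.toNat)
  else 0

lemma toeplitzF_apply {N : ℕ} (i j : Fin N) :
    toeplitzF N i j =
      if (j : ℕ) = i + 2 then X 0 else if (j : ℕ) = i + 1 then X 1
      else if (j : ℕ) = i then X 2 else if (j : ℕ) + 1 = i then X 3 else 0 := by
  have key : ∀ (z : ℤ) (t : Fin 4), 2 + (i : ℤ) - (j : ℤ) = z → z = (t : ℕ) →
      toeplitzF N i j = X t := by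
    intro z t hz ht
    have := t.isLt
    simp only [toeplitzF, Matrix.of_apply]
    rw [dif_pos (by omega)]
    congr 1
    ext
    simp only
    omega
  split_ifs with h0 h1 h2 h3
  · exact key 0 0 (by omega) rfl
  · exact key 1 1 (by omega) rfl
  · exact key 2 2 (by omega) rfl
  · exact key 3 3 (by omega) rfl
  · simp only [toeplitzF, Matrix.of_apply]
    rw [dif_neg (by omega)]

lemma det_toeplitzF_two : (toeplitzF 2).det = X 2 * (toeplitzF 1).det - X 1 * X 3 := by
  simp [Matrix.det_fin_two, toeplitzF_apply]

lemma toeplitzF_submatrix_succ (n : ℕ) :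
    (toeplitzF (n + 1)).submatrix Fin.succ Fin.succ = toeplitzF n := by
  ext1 i j
  simp [toeplitzF_apply, add_right_comm _ 1]

lemma det_toeplitzF_add_three (n : ℕ) :
    (toeplitzF (n + 3)).det = X 2 * (toeplitzF (n + 2)).det
      - X 1 * (X 3 * (toeplitzF (n + 1)).det) + X 0 * (X 3 * (X 3 * (toeplitzF n).det)) := by
  set A := toeplitzF (n + 3) with hA
  set B := A.submatrix (Fin.succAbove 1) Fin.succ with hB
  set C := B.submatrix (Fin.succAbove 1) Fin.succ with hC
  have hAB : A.det = X 2 * (toeplitzF (n + 2)).det - X 3 * B.det := by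
    rw [Matrix.det_succ_column_zero, Fin.sum_univ_succ, Fin.sum_univ_succ, Finset.sum_eq_zero]
    · simp [hA, hB, toeplitzF_apply, ← toeplitzF_submatrix_succ (n + 2)]
      ring
    · intro i _
      simp [hA, toeplitzF_apply]
  have hBC : B.det = X 1 * (toeplitzF (n + 1)).det - X 3 * C.det := by
    have h0 : B.submatrix Fin.succ Fin.succ = toeplitzF (n + 1) := by
      rw [← toeplitzF_submatrix_succ, ← toeplitzF_submatrix_succ (n + 2)]
      ext1 i j
      simp [hB, hA, Fin.succAbove, Fin.lt_def]
    rw [Matrix.det_succ_column_zero, Fin.sum_univ_succ, Fin.sum_univ_succ, Finset.sum_eq_zero]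
    · have h00 : B 0 0 = X 1 := by simp [hA, hB, toeplitzF_apply]
      have h10 : B 1 0 = X 3 := by
        simp [hA, hB, toeplitzF_apply, Fin.succAbove, Nat.mod_eq_of_lt]
      simp [h0, h00, h10, ← hC]
      ring
    · intro i _
      simp [hA, hB, toeplitzF_apply, Fin.succAbove, Fin.lt_def]
  have hC' : C.det = X 0 * (toeplitzF n).det := by
    have h0 : C.submatrix Fin.succ Fin.succ = toeplitzF n := by
      rw [← toeplitzF_submatrix_succ, ← toeplitzF_submatrix_succ (n + 1),
        ← toeplitzF_submatrix_succ (n + 2)]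
      ext1 i j
      simp [hC, hB, hA, Fin.succAbove, Fin.lt_def]
    rw [Matrix.det_succ_row_zero, Fin.sum_univ_succ, Finset.sum_eq_zero]
    · have h00 : C 0 0 = X 0 := by simp [hA, hB, hC, toeplitzF_apply]
      simp [h0, h00]
    · intro i _
      simp [hA, hB, hC, toeplitzF_apply, Fin.succAbove]
  rw [hAB, hBC, hC']
  ring

/-- The determinant of `toeplitzF`, extended by zero to negative dimensions. -/
def detToeplitz (n : ℤ) : MvPolynomial (Fin 4) ℤ :=
  if 0 ≤ n then (toeplitzF n.toNat).det else 0

lemma detToeplitz_natCast (n : ℕ) : detToeplitz n = (toeplitzF n).det := by simp [detToeplitz]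

lemma detToeplitz_recurrence {n : ℤ} (hn : 1 ≤ n) :
    detToeplitz n = X 2 * detToeplitz (n - 1) - X 1 * (X 3 * detToeplitz (n - 2))
      + X 0 * (X 3 * (X 3 * detToeplitz (n - 3))) := by
  obtain ⟨n, rfl⟩ := Int.eq_ofNat_of_zero_le (by omega : 0 ≤ n)
  match n, hn with
  | 1, _ => simp [detToeplitz, toeplitzF_apply]
  | 2, _ => simp [detToeplitz, det_toeplitzF_two]
  | n + 3, _ =>
    rw [show ((n + 3 : ℕ) : ℤ) - 1 = (n + 2 : ℕ) by push_cast; ring,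
      show ((n + 3 : ℕ) : ℤ) - 2 = (n + 1 : ℕ) by push_cast; ring,
      show ((n + 3 : ℕ) : ℤ) - 3 = (n : ℕ) by push_cast; ring]
    simp only [detToeplitz_natCast, det_toeplitzF_add_three]

/-- The coefficient of `f₀^a f₁^b f₂^c f₃^d` in `p`, zero if an exponent is negative. -/
def coeffInt (a b c d : ℤ) (p : MvPolynomial (Fin 4) ℤ) : ℤ :=
  if 0 ≤ a ∧ 0 ≤ b ∧ 0 ≤ c ∧ 0 ≤ d then
    p.coeff (Finsupp.single 0 a.toNat + Finsupp.single 1 b.toNat +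
      Finsupp.single 2 c.toNat + Finsupp.single 3 d.toNat)
  else 0

lemma Fc_eq_coeffInt {a b c d n : ℤ} (hn : a + b + c + d = n) :
    Fc a b c d = coeffInt a b c d (detToeplitz n) := by
  subst hn
  unfold Fc coeffInt
  split_ifs with h h0
  · obtain ⟨rfl, rfl, rfl, rfl⟩ := h0
    simp [detToeplitz]
  · rw [detToeplitz, if_pos (by omega)]
  · rfl

lemma coeffInt_add (a b c d : ℤ) (p q : MvPolynomial (Fin 4) ℤ) :
    coeffInt a b c d (p + q) = coeffInt a b c d p + coeffInt a b c d q := by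
  unfold coeffInt
  split_ifs <;> simp

lemma coeffInt_sub (a b c d : ℤ) (p q : MvPolynomial (Fin 4) ℤ) :
    coeffInt a b c d (p - q) = coeffInt a b c d p - coeffInt a b c d q := by
  unfold coeffInt
  split_ifs <;> simp

lemma coeffInt_X_mul (a b c d : ℤ) (p : MvPolynomial (Fin 4) ℤ) (t : Fin 4) :
    coeffInt a b c d (X t * p) =
      coeffInt (a - if t = 0 then 1 else 0) (b - if t = 1 then 1 else 0)
        (c - if t = 2 then 1 else 0) (d - if t = 3 then 1 else 0) p := by
  unfold coeffInt
  rw [coeff_X_mul']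
  fin_cases t <;> simp <;> split_ifs <;> first | omega | rfl | skip
  all_goals
    congr 1
    ext s
    fin_cases s <;> simp

/-- `F` satisfies the recurrence
`F(m,k,k',m') = F(m,k,k'-1,m') - F(m,k-1,k',m'-1) + F(m-1,k,k',m'-2)`
for all nonnegative integers `m, k, k', m'` with `m+k+k'+m' ≥ 1`. -/
theorem Fc_recurrence (m k k' m' : ℤ) (hm : 0 ≤ m) (hk : 0 ≤ k) (hk' : 0 ≤ k')
    (hm' : 0 ≤ m') (hsum : 1 ≤ m + k + k' + m') :
    Fc m k k' m' = Fc m k (k' - 1) m' - Fc m (k - 1) k' (m' - 1) + Fc (m - 1) k k' (m' - 2) := by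
  rw [Fc_eq_coeffInt rfl, detToeplitz_recurrence hsum,
    Fc_eq_coeffInt (n := m + k + k' + m' - 1) (by ring),
    Fc_eq_coeffInt (n := m + k + k' + m' - 2) (by ring),
    Fc_eq_coeffInt (n := m + k + k' + m' - 3) (by ring),
    coeffInt_add, coeffInt_sub]
  simp [coeffInt_X_mul, sub_sub]
end
end

section
/- For all nonnegative integers m, k, k': F(m, k, k', k+2m) = (−1)^k · C(m+k, k) · C(k'+k+m, k+m), where C denotes the binomial coefficient. Moreover, if m' ≠ 2m + k then F(m, k, k', m') = 0. -/
noncomputable section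

open MvPolynomial

/-- The matrix `toeplitzF (n + 1)` with its first row replaced by `r`. -/
def toeplitzRow (n : ℕ) (r : ℕ → MvPolynomial (Fin 4) ℤ) :
    Matrix (Fin (n + 1)) (Fin (n + 1)) (MvPolynomial (Fin 4) ℤ) :=
  Matrix.of fun i j => if i = 0 then r j else toeplitzF (n + 1) i j

/-- The first row of the banded Toeplitz matrix. -/
def bandRow : ℕ → MvPolynomial (Fin 4) ℤ
  | 0 => X 2
  | 1 => X 1
  | 2 => X 0
  | _ + 3 => 0

theorem toeplitzRow_bandRow (n : ℕ) : toeplitzRow n bandRow = toeplitzF (n + 1) := by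
  ext1 i j
  simp only [toeplitzRow, Matrix.of_apply]
  split_ifs with h
  · subst h
    obtain ⟨j, hj⟩ := j
    match j with
    | 0 => simp [toeplitzF, bandRow]
    | 1 => simp [toeplitzF, bandRow]
    | 2 => simp [toeplitzF, bandRow]
    | j + 3 =>
      rw [toeplitzF, Matrix.of_apply, dif_neg]
      · rfl
      · simp only [Fin.val_zero]
        push_cast
        omega
  · rfl

theorem toeplitzF_congr {m n : ℕ} {i j : Fin m} {i' j' : Fin n}
    (h : (i : ℤ) - j = (i' : ℤ) - j') : toeplitzF m i j = toeplitzF n i' j' := by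
  have h' : 2 + (i : ℤ) - j = 2 + (i' : ℤ) - j' := by omega
  simp only [toeplitzF, Matrix.of_apply, h']

theorem det_toeplitzRow_succ (n : ℕ) (r : ℕ → MvPolynomial (Fin 4) ℤ) :
    (toeplitzRow (n + 1) r).det =
      r 0 * (toeplitzF (n + 1)).det - X 3 * (toeplitzRow n fun j => r (j + 1)).det := by
  have h0 : (toeplitzRow (n + 1) r).submatrix (Fin.succAbove 0) Fin.succ = toeplitzF (n + 1) := by
    ext1 i j
    simp only [toeplitzRow, Matrix.submatrix_apply, Matrix.of_apply, Fin.zero_succAbove,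
      Fin.succ_ne_zero, if_false]
    exact toeplitzF_congr (by simp)
  have h1 : (toeplitzRow (n + 1) r).submatrix (Fin.succAbove (Fin.succ 0)) Fin.succ =
      toeplitzRow n fun j => r (j + 1) := by
    ext1 i j
    refine Fin.cases ?_ (fun i => ?_) i
    · simp [toeplitzRow]
    · simp only [toeplitzRow, Matrix.submatrix_apply, Matrix.of_apply, Fin.succ_succAbove_succ,
        Fin.zero_succAbove, Fin.succ_ne_zero, if_false]
      exact toeplitzF_congr (by simp)
  rw [Matrix.det_succ_column_zero, Fin.sum_univ_succ, Fin.sum_univ_succ, h0, h1,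
    Finset.sum_eq_zero]
  · have h3 : toeplitzRow (n + 1) r (Fin.succ 0) 0 = X 3 := by
      simp [toeplitzRow, toeplitzF]
    rw [h3]
    simp [toeplitzRow]
    ring
  · intro i _
    have h4 : toeplitzRow (n + 1) r i.succ.succ 0 = 0 := by
      rw [toeplitzRow, Matrix.of_apply, if_neg (Fin.succ_ne_zero _), toeplitzF, Matrix.of_apply,
        dif_neg]
      simp only [Fin.val_succ, Fin.val_zero]
      push_cast
      omega
    rw [h4]
    simp

theorem det_toeplitzRow_zero (r : ℕ → MvPolynomial (Fin 4) ℤ) :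
    (toeplitzRow 0 r).det = r 0 := by
  simp [toeplitzRow]

theorem det_toeplitzRow_eq_zero (n : ℕ) : (toeplitzRow n fun _ => 0).det = 0 :=
  Matrix.det_eq_zero_of_row_eq_zero 0 fun j => by simp [toeplitzRow]

/-- The determinants of the matrices `toeplitzF`, delayed by two initial zeros so that a single
three-term recurrence holds from the start. -/
def delayedDet : ℕ → MvPolynomial (Fin 4) ℤ
  | 0 => 0
  | 1 => 0
  | n + 2 => (toeplitzF n).det

theorem delayedDet_add_three (n : ℕ) :
    delayedDet (n + 3) = X 2 * delayedDet (n + 2) - X 1 * (X 3 * delayedDet (n + 1)) +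
      X 0 * (X 3 * (X 3 * delayedDet n)) := by
  match n with
  | 0 =>
    simp only [delayedDet]
    rw [← toeplitzRow_bandRow, det_toeplitzRow_zero]
    simp [bandRow]
  | 1 =>
    simp only [delayedDet]
    rw [← toeplitzRow_bandRow 1, det_toeplitzRow_succ, det_toeplitzRow_zero]
    simp [bandRow]
    ring
  | n + 2 =>
    simp only [delayedDet]
    rw [← toeplitzRow_bandRow (n + 2), det_toeplitzRow_succ, det_toeplitzRow_succ]
    cases n with
    | zero =>
      rw [det_toeplitzRow_zero]
      simp [bandRow]
      ring
    | succ n =>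
      rw [det_toeplitzRow_succ]
      simp only [bandRow, det_toeplitzRow_eq_zero]
      ring

/-- The exponent vector of `f₀^a f₁^b f₂^c f₃^d`. -/
def bandExponent (a b c d : ℕ) : Fin 4 →₀ ℕ :=
  Finsupp.single 0 a + Finsupp.single 1 b + Finsupp.single 2 c + Finsupp.single 3 d

theorem coeff_X_mul_bandExponent (p : MvPolynomial (Fin 4) ℤ) (a b c d : ℕ) :
    coeff (bandExponent a b c d) (X 0 * p) =
        (if a = 0 then 0 else coeff (bandExponent (a - 1) b c d) p) ∧
      coeff (bandExponent a b c d) (X 1 * p) =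
        (if b = 0 then 0 else coeff (bandExponent a (b - 1) c d) p) ∧
      coeff (bandExponent a b c d) (X 2 * p) =
        (if c = 0 then 0 else coeff (bandExponent a b (c - 1) d) p) ∧
      coeff (bandExponent a b c d) (X 3 * p) =
        (if d = 0 then 0 else coeff (bandExponent a b c (d - 1)) p) := by
  have h0 : bandExponent a b c d - Finsupp.single 0 1 = bandExponent (a - 1) b c d := by
    ext i; fin_cases i <;> simp [bandExponent]
  have h1 : bandExponent a b c d - Finsupp.single 1 1 = bandExponent a (b - 1) c d := by
    ext i; fin_cases i <;> simp [bandExponent]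
  have h2 : bandExponent a b c d - Finsupp.single 2 1 = bandExponent a b (c - 1) d := by
    ext i; fin_cases i <;> simp [bandExponent]
  have h3 : bandExponent a b c d - Finsupp.single 3 1 = bandExponent a b c (d - 1) := by
    ext i; fin_cases i <;> simp [bandExponent]
  simp only [coeff_X_mul', h0, h1, h2, h3]
  simp [bandExponent, ite_not]

/-- The signed multinomial coefficient `(-1)^b (a + b + c)! / (a! b! c!)`. -/
def signedTrinomial (a b c : ℕ) : ℤ :=
  (-1) ^ b * ((a + b).choose b : ℤ) * ((c + b + a).choose (b + a) : ℤ)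

theorem signedTrinomial_pascal (a b c : ℕ) (h : a + b + c ≠ 0) :
    signedTrinomial a b c =
      (if c = 0 then 0 else signedTrinomial a b (c - 1)) -
        (if b = 0 then 0 else signedTrinomial a (b - 1) c) +
          (if a = 0 then 0 else signedTrinomial (a - 1) b c) := by
  have hb : ∀ a b : ℕ, a + b ≠ 0 → (a + b).choose b =
      (if b = 0 then 0 else (a + (b - 1)).choose (b - 1)) +
        (if a = 0 then 0 else (a - 1 + b).choose b) := by
    intro a b hab
    rcases a with _ | a <;> rcases b with _ | b
    · simp at hab
    · simp
    · simp
    · have := Nat.choose_succ_succ (a + 1 + b) b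
      simp only [Nat.add_sub_cancel, if_neg (Nat.succ_ne_zero _)]
      rw [show a + (b + 1) = a + 1 + b by ring]
      exact this
  by_cases hn : a + b = 0
  · obtain ⟨rfl, rfl⟩ : a = 0 ∧ b = 0 := by omega
    have : c ≠ 0 := by omega
    simp [signedTrinomial, this]
  · have h1 := hb c (a + b) (by omega)
    have h2 := hb a b hn
    rw [if_neg hn] at h1
    simp only [signedTrinomial]
    rw [show c + b + a = c + (a + b) by ring, show b + a = a + b by ring, h1]
    have e1 : ∀ x, x + b + a = x + (a + b) := fun x => by ring
    have e2 : b ≠ 0 → c + (b - 1) + a = c + (a + b - 1) ∧ b - 1 + a = a + b - 1 ∧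
        (-1 : ℤ) ^ b = -(-1) ^ (b - 1) := fun hb0 => by
      obtain ⟨b, rfl⟩ := Nat.exists_eq_succ_of_ne_zero hb0
      refine ⟨by omega, by omega, ?_⟩
      simp [pow_succ]
    have e3 : a ≠ 0 → c + b + (a - 1) = c + (a + b - 1) ∧ b + (a - 1) = a + b - 1 := fun ha0 => by
      omega
    rw [e1]
    have h3 : (if b = 0 then (0 : ℤ) else (-1) ^ (b - 1) * ((a + (b - 1)).choose (b - 1) : ℤ) *
          ((c + (b - 1) + a).choose (b - 1 + a) : ℤ)) =
        -(-1) ^ b * ((if b = 0 then 0 else (a + (b - 1)).choose (b - 1) : ℕ) : ℤ) *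
          ((c + (a + b - 1)).choose (a + b - 1) : ℤ) := by
      split_ifs with hb0
      · simp
      · rw [(e2 hb0).1, (e2 hb0).2.1, (e2 hb0).2.2]
        ring
    have h4 : (if a = 0 then (0 : ℤ) else (-1) ^ b * ((a - 1 + b).choose b : ℤ) *
          ((c + b + (a - 1)).choose (b + (a - 1)) : ℤ)) =
        (-1) ^ b * ((if a = 0 then 0 else (a - 1 + b).choose b : ℕ) : ℤ) *
          ((c + (a + b - 1)).choose (a + b - 1) : ℤ) := by
      split_ifs with ha0
      · simp
      · rw [(e3 ha0).1, (e3 ha0).2]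
    have h5 : (if c = 0 then (0 : ℤ) else (-1) ^ b * ((a + b).choose b : ℤ) *
          ((c - 1 + (a + b)).choose (a + b) : ℤ)) =
        (-1) ^ b * ((a + b).choose b : ℤ) *
          ((if c = 0 then 0 else (c - 1 + (a + b)).choose (a + b) : ℕ) : ℤ) := by
      split_ifs <;> simp
    rw [h3, h4, h5, Nat.cast_add]
    have h6 := congrArg (Nat.cast : ℕ → ℤ) h2
    rw [Nat.cast_add] at h6
    linear_combination (-1) ^ b * ((c + (a + b - 1)).choose (a + b - 1) : ℤ) * h6

theorem coeff_delayedDet (n a b c d : ℕ) :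
    coeff (bandExponent a b c d) (delayedDet n) =
      if d = 2 * a + b ∧ n = c + 2 * b + 3 * a + 2 then signedTrinomial a b c else 0 := by
  induction n using Nat.strong_induction_on generalizing a b c d with
  | _ n ih =>
  match n with
  | 0 => simp [delayedDet]
  | 1 =>
    rw [if_neg (by omega)]
    simp [delayedDet]
  | 2 =>
    have h : (0 : Fin 4 →₀ ℕ) = bandExponent a b c d ↔
        d = 2 * a + b ∧ 2 = c + 2 * b + 3 * a + 2 := by
      rw [Finsupp.ext_iff]
      simp [Fin.forall_fin_succ, bandExponent]
      omega
    simp only [delayedDet, Matrix.det_isEmpty, coeff_one, h]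
    refine if_ctx_congr Iff.rfl (fun h' => ?_) fun _ => rfl
    obtain ⟨rfl, rfl, rfl⟩ : a = 0 ∧ b = 0 ∧ c = 0 := by omega
    simp [signedTrinomial]
  | n + 3 =>
    rw [delayedDet_add_three, coeff_add, coeff_sub]
    simp only [coeff_X_mul_bandExponent, ih (n + 2) (by omega), ih (n + 1) (by omega),
      ih n (by omega)]
    by_cases h : d = 2 * a + b ∧ n + 3 = c + 2 * b + 3 * a + 2
    · rw [if_pos h, signedTrinomial_pascal a b c (by omega)]
      congr 1
      · congr 1 <;> split_ifs <;> first | rfl | omega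
      · split_ifs <;> first | rfl | omega
    · rw [if_neg h]
      split_ifs <;> first | rfl | omega

theorem Fc_natCast (m k k' m' : ℕ) :
    Fc m k k' m' = if m' = 2 * m + k then signedTrinomial m k k' else 0 := by
  have key := coeff_delayedDet (m + k + k' + m' + 2) m k k' m'
  unfold Fc
  rw [if_pos (by omega)]
  split_ifs with h h' h'
  · obtain ⟨rfl, rfl, rfl⟩ : m = 0 ∧ k = 0 ∧ k' = 0 := by omega
    simp [signedTrinomial]
  · omega
  · rw [if_pos (by omega)] at key
    rw [← key]
    rfl
  · rw [if_neg (by omega)] at key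
    rw [← key]
    rfl

/-- For all nonnegative integers `m, k, k'`:
`F(m,k,k',k+2m) = (-1)^k ⬝ C(m+k,k) ⬝ C(k'+k+m,k+m)`;
moreover if `m' ≠ 2m + k` then `F(m,k,k',m') = 0`. -/
theorem Fc_eq_binomial :
    (∀ m k k' : ℕ,
      Fc m k k' (k + 2 * m) =
        (-1) ^ k * ((m + k).choose k : ℤ) * ((k' + k + m).choose (k + m) : ℤ)) ∧
    (∀ m k k' m' : ℕ, (m' : ℤ) ≠ 2 * m + k → Fc m k k' m' = 0) := by
  refine ⟨fun m k k' => ?_, fun m k k' m' h => ?_⟩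
  · have h := Fc_natCast m k k' (k + 2 * m)
    rw [if_pos (by ring)] at h
    push_cast at h
    exact h
  · rw [Fc_natCast, if_neg (by omega)]
end
end
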